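/- arXiv:math/9912134 — 3 statements merged into one kernel-verified Lean document; each statement's English description precedes it below -/
import Mathlib

section
/- For every finite hypergraph F of closed intervals on the real line, imw(F) = iw(F): there exists a matching M in F such that every matching in F covering M has size at least iw(F). -/
/-- The closed interval associated to a pair. -/
def Iv (p : ℝ × ℝ) : Set ℝ := Set.Icc p.1 p.2

/-- Two intervals meet (intersect). -/
def Meets (p q : ℝ × ℝ) : Prop := (Iv p ∩ Iv q).Nonempty

/-- `C` covers `M`: every interval of `M` meets some interval of `C`. -/
def IntCovers (C M : Finset (ℝ × ℝ)) : Prop := ∀ p ∈ M, ∃ q ∈ C, Meets p q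

/-- A matching of intervals: pairwise disjoint. -/
def IntMatching (M : Finset (ℝ × ℝ)) : Prop := ∀ p ∈ M, ∀ q ∈ M, p ≠ q → ¬ Meets p q

/-- `iw(M, F)`: minimal size of a matching in `F` covering `M`. -/
noncomputable def iwRel (M F : Finset (ℝ × ℝ)) : ℕ :=
  sInf {n | ∃ C ⊆ F, IntMatching C ∧ IntCovers C M ∧ C.card = n}

/-- `iw(F)`: minimal size of a matching in `F` covering `F`. -/
noncomputable def iw (F : Finset (ℝ × ℝ)) : ℕ := iwRel F F

/-- `imw(F)`: maximum of `iw(M, F)` over matchings `M` in `F`. -/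
noncomputable def imw (F : Finset (ℝ × ℝ)) : ℕ :=
  sSup {n | ∃ M ⊆ F, IntMatching M ∧ iwRel M F = n}

theorem meets_iff (p q : ℝ × ℝ) :
    Meets p q ↔ p.1 ≤ p.2 ∧ p.1 ≤ q.2 ∧ q.1 ≤ p.2 ∧ q.1 ≤ q.2 := by
  unfold Meets Iv
  rw [Set.Icc_inter_Icc, Set.nonempty_Icc]
  simp only [sup_le_iff, le_inf_iff]
  tauto

theorem meets_symm {p q : ℝ × ℝ} (h : Meets p q) : Meets q p := by
  rw [meets_iff] at *; tauto

theorem matching_insert {C : Finset (ℝ × ℝ)} {K : ℝ × ℝ} (hC : IntMatching C)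
    (h : ∀ c ∈ C, ¬ Meets K c) : IntMatching (insert K C) := by
  intro p hp q hq hne hm
  rw [Finset.mem_insert] at hp hq
  rcases hp with rfl | hp
  · rcases hq with rfl | hq
    · exact hne rfl
    · exact h q hq hm
  · rcases hq with rfl | hq
    · exact h p hp (meets_symm hm)
    · exact hC p hp q hq hne hm

theorem exists_cover (F : Finset (ℝ × ℝ)) (hF : ∀ p ∈ F, p.1 ≤ p.2) :
    ∃ C ⊆ F, IntMatching C ∧ IntCovers C F := by
  classical
  induction F using Finset.induction_on with
  | empty => exact ⟨∅, by simp, by intro p hp; simp at hp, by intro p hp; simp at hp⟩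
  | insert K F hK ih =>
    obtain ⟨C, hCF, hC, hcov⟩ := ih (fun p hp => hF p (Finset.mem_insert_of_mem hp))
    by_cases h : ∃ c ∈ C, Meets K c
    · refine ⟨C, hCF.trans (Finset.subset_insert _ _), hC, ?_⟩
      intro p hp
      rcases Finset.mem_insert.1 hp with rfl | hp
      · exact h
      · exact hcov p hp
    · push Not at h
      refine ⟨insert K C, Finset.insert_subset_insert _ hCF, matching_insert hC h, ?_⟩
      intro p hp
      rcases Finset.mem_insert.1 hp with rfl | hp
      · have := hF p (Finset.mem_insert_self _ _)
        exact ⟨p, Finset.mem_insert_self _ _, (meets_iff _ _).2 ⟨this, this, this, this⟩⟩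
      · obtain ⟨q, hq, hm⟩ := hcov p hp
        exact ⟨q, Finset.mem_insert_of_mem hq, hm⟩

theorem iw_spec (F : Finset (ℝ × ℝ)) (hF : ∀ p ∈ F, p.1 ≤ p.2) :
    ∃ C ⊆ F, IntMatching C ∧ IntCovers C F ∧ C.card = iw F := by
  have h : {n | ∃ C ⊆ F, IntMatching C ∧ IntCovers C F ∧ C.card = n}.Nonempty := by
    obtain ⟨C, h1, h2, h3⟩ := exists_cover F hF
    exact ⟨C.card, C, h1, h2, h3, rfl⟩
  exact Nat.sInf_mem h

theorem iwRel_le {M F C : Finset (ℝ × ℝ)} (h1 : C ⊆ F) (h2 : IntMatching C)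
    (h3 : IntCovers C M) : iwRel M F ≤ C.card :=
  Nat.sInf_le ⟨C, h1, h2, h3, rfl⟩

theorem iw_le {F C : Finset (ℝ × ℝ)} (h1 : C ⊆ F) (h2 : IntMatching C)
    (h3 : IntCovers C F) : iw F ≤ C.card := iwRel_le h1 h2 h3

/-- optimal cover of `F` reaching at least `t` on the right -/
def Reach (F : Finset (ℝ × ℝ)) (t : ℝ) : Prop :=
  ∃ C ⊆ F, IntMatching C ∧ IntCovers C F ∧ C.card = iw F ∧ ∃ c ∈ C, t ≤ c.2

/-- the inductive invariant -/
structure IvInv (F M : Finset (ℝ × ℝ)) : Prop where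
  sub : M ⊆ F
  mat : IntMatching M
  low : ∀ C ⊆ F, IntMatching C → IntCovers C M → iw F ≤ C.card
  lowz : ∀ z : ℝ, ∀ C ⊆ F.filter (fun p => p.2 < z), IntMatching C →
    IntCovers C (M.filter (fun p => p.2 < z)) → iw (F.filter (fun p => p.2 < z)) ≤ C.card
  reachM : ∀ q ∈ M, Reach F q.2
  reachC : ∀ C ⊆ F, IntMatching C → IntCovers C M → C.card = iw F → ∀ c ∈ C, Reach F c.2

theorem main_inv (F : Finset (ℝ × ℝ)) (hF : ∀ p ∈ F, p.1 ≤ p.2) : ∃ M, IvInv F M := by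
  classical
  induction F using Finset.induction_on_max_value (fun p : ℝ × ℝ => p.2) with
  | empty =>
    have h0 : iw ∅ = 0 := by
      have := iw_le (F := ∅) (C := ∅) (by simp) (by intro p hp; simp at hp)
        (by intro p hp; simp at hp)
      simpa using this
    refine ⟨∅, by simp, by intro p hp; simp at hp, ?_, ?_, ?_, ?_⟩
    · intro C _ _ _; simp [h0]
    · intro z C _ _ _; simp [h0]
    · intro q hq; simp at hq
    · intro C hC _ _ _ c hc
      have := hC hc
      simp at this
  | insert K F hK hmax ih =>
    have hF0 : ∀ p ∈ F, p.1 ≤ p.2 := fun p hp => hF p (Finset.mem_insert_of_mem hp)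
    have hKv : K.1 ≤ K.2 := hF K (Finset.mem_insert_self _ _)
    obtain ⟨M, hM⟩ := ih hF0
    have hmeet : ∀ p ∈ F, (Meets K p ↔ K.1 ≤ p.2) := by
      intro p hp
      rw [meets_iff]
      have h1 := hF0 p hp
      have h2 := hmax p hp
      exact ⟨fun h => h.2.1, fun h => ⟨hKv, h, h1.trans h2, h1⟩⟩
    have hKK : Meets K K := (meets_iff _ _).2 ⟨hKv, hKv, hKv, hKv⟩
    have hmax' : ∀ p ∈ insert K F, p.2 ≤ K.2 := by
      intro p hp
      rcases Finset.mem_insert.1 hp with rfl | hp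
      · exact le_rfl
      · exact hmax p hp
    -- an optimal cover of F meeting K gives iw F' ≤ iw F
    have hcovK : ∀ C ⊆ F, IntCovers C F → (∃ c ∈ C, K.1 ≤ c.2) → IntCovers C (insert K F) := by
      rintro C hC hcov ⟨c, hc, hk⟩ p hp
      rcases Finset.mem_insert.1 hp with rfl | hp
      · exact ⟨c, hc, (hmeet c (hC hc)).2 hk⟩
      · exact hcov p hp
    have hreach_le : Reach F K.1 → iw (insert K F) ≤ iw F := by
      rintro ⟨C, hC, hmat, hcov, hcard, hr⟩
      rw [← hcard]
      exact iw_le (hC.trans (Finset.subset_insert _ _)) hmat (hcovK C hC hcov hr)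
    -- covers of M using K
    have hwithK : ∀ C ⊆ insert K F, IntMatching C → IntCovers C M → K ∈ C →
        ∃ C' ⊆ insert K F, IntMatching C' ∧ IntCovers C' (insert K F) ∧ C'.card ≤ C.card ∧
          K ∈ C' := by
      intro C hC hmat hcov hKC
      have hG0 : ∀ p ∈ F.filter (fun p => p.2 < K.1), p.1 ≤ p.2 :=
        fun p hp => hF0 p (Finset.mem_filter.1 hp).1
      have h1 : iw (F.filter (fun p => p.2 < K.1)) ≤ (C.erase K).card := by
        apply hM.lowz K.1 (C.erase K)
        · intro p hp
          obtain ⟨hpK, hpC⟩ := Finset.mem_erase.1 hp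
          have hpF : p ∈ F := (Finset.mem_insert.1 (hC hpC)).resolve_left hpK
          refine Finset.mem_filter.2 ⟨hpF, ?_⟩
          by_contra hlt
          exact hmat K hKC p hpC (Ne.symm hpK) ((hmeet p hpF).2 (not_lt.1 hlt))
        · intro p hp q hq
          exact hmat p (Finset.mem_of_mem_erase hp) q (Finset.mem_of_mem_erase hq)
        · intro p hp
          obtain ⟨hpM, hlt⟩ := Finset.mem_filter.1 hp
          obtain ⟨q, hq, hm⟩ := hcov p hpM
          refine ⟨q, Finset.mem_erase.2 ⟨?_, hq⟩, hm⟩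
          rintro rfl
          exact absurd ((hmeet p (hM.sub hpM)).1 (meets_symm hm)) (not_le.2 hlt)
      obtain ⟨C0, hC0, hmat0, hcov0, hcard0⟩ := iw_spec _ hG0
      refine ⟨insert K C0, ?_, ?_, ?_, ?_, Finset.mem_insert_self _ _⟩
      · exact Finset.insert_subset_insert _ (hC0.trans (Finset.filter_subset _ _))
      · apply matching_insert hmat0
        intro c hc hm
        obtain ⟨hcF, hlt⟩ := Finset.mem_filter.1 (hC0 hc)
        exact absurd ((hmeet c hcF).1 hm) (not_le.2 hlt)
      · intro p hp
        rcases Finset.mem_insert.1 hp with rfl | hp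
        · exact ⟨p, Finset.mem_insert_self _ _, hKK⟩
        · by_cases hlt : p.2 < K.1
          · obtain ⟨q, hq, hm⟩ := hcov0 p (Finset.mem_filter.2 ⟨hp, hlt⟩)
            exact ⟨q, Finset.mem_insert_of_mem hq, hm⟩
          · exact ⟨K, Finset.mem_insert_self _ _,
              meets_symm ((hmeet p hp).2 (not_lt.1 hlt))⟩
      · have h2 := Finset.card_insert_le K C0
        have h3 := Finset.card_erase_add_one hKC
        omega
    have hsubF : ∀ C ⊆ insert K F, K ∉ C → C ⊆ F := by
      intro C hC hKC p hp
      refine (Finset.mem_insert.1 (hC hp)).resolve_left ?_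
      rintro rfl
      exact hKC hp
    -- lowz follows from low
    have hlowz : ∀ M', M' ⊆ insert K F → (∀ p, p ≠ K → (p ∈ M' ↔ p ∈ M)) →
        (∀ C ⊆ insert K F, IntMatching C → IntCovers C M' → iw (insert K F) ≤ C.card) →
        ∀ z : ℝ, ∀ C ⊆ (insert K F).filter (fun p => p.2 < z), IntMatching C →
        IntCovers C (M'.filter (fun p => p.2 < z)) →
        iw ((insert K F).filter (fun p => p.2 < z)) ≤ C.card := by
      intro M' hM' hMM hlow z C hC hmat hcov
      by_cases hz : K.2 < z
      · have e1 : (insert K F).filter (fun p => p.2 < z) = insert K F :=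
          Finset.filter_true_of_mem (fun p hp => (hmax' p hp).trans_lt hz)
        have e2 : M'.filter (fun p => p.2 < z) = M' :=
          Finset.filter_true_of_mem (fun p hp => (hmax' p (hM' hp)).trans_lt hz)
        rw [e1] at hC ⊢
        rw [e2] at hcov
        exact hlow C hC hmat hcov
      · have e1 : (insert K F).filter (fun p => p.2 < z) = F.filter (fun p => p.2 < z) := by
          rw [Finset.filter_insert, if_neg hz]
        have e2 : M'.filter (fun p => p.2 < z) = M.filter (fun p => p.2 < z) := by
          ext p
          simp only [Finset.mem_filter]
          constructor
          · rintro ⟨h1, h2⟩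
            exact ⟨(hMM p (by rintro rfl; exact hz h2)).1 h1, h2⟩
          · rintro ⟨h1, h2⟩
            exact ⟨(hMM p (by rintro rfl; exact hz h2)).2 h1, h2⟩
        rw [e1] at hC ⊢
        rw [e2] at hcov
        exact hM.lowz z C hC hmat hcov
    have hsub' : F ⊆ insert K F := Finset.subset_insert _ _
    by_cases hn : iw (insert K F) ≤ iw F
    · -- M unchanged
      have hlow : ∀ C ⊆ insert K F, IntMatching C → IntCovers C M →
          iw (insert K F) ≤ C.card := by
        intro C hC hmat hcov
        by_cases hKC : K ∈ C
        · obtain ⟨C', h1, h2, h3, h4, _⟩ := hwithK C hC hmat hcov hKC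
          exact (iw_le h1 h2 h3).trans h4
        · exact hn.trans (hM.low C (hsubF C hC hKC) hmat hcov)
      have hstep : ∀ t ≤ K.2, Reach F t → Reach (insert K F) t := by
        rintro t ht ⟨C, hC, hmat, hcov, hcard, c, hc, hct⟩
        obtain ⟨C', hC', hmat', hcov', hcard'⟩ := iw_spec _ hF
        by_cases hr : ∃ c ∈ C', t ≤ c.2
        · exact ⟨C', hC', hmat', hcov', hcard', hr⟩
        · push Not at hr
          have hKC' : K ∉ C' := fun h => absurd (hr K h) (not_lt.2 ht)
          have hCF' := hsubF C' hC' hKC'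
          have hle : iw F ≤ C'.card :=
            iw_le hCF' hmat' (fun p hp => hcov' p (hsub' hp))
          obtain ⟨c', hc', hm'⟩ := hcov' K (Finset.mem_insert_self _ _)
          have h1 := (hmeet c' (hCF' hc')).1 hm'
          have h2 := hr c' hc'
          exact ⟨C, hC.trans hsub', hmat,
            hcovK C hC hcov ⟨c, hc, h1.trans (h2.le.trans hct)⟩, by omega, c, hc, hct⟩
      refine ⟨M, hM.sub.trans hsub', hM.mat, hlow,
        hlowz M (hM.sub.trans hsub') (fun _ _ => Iff.rfl) hlow, ?_, ?_⟩
      · intro q hq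
        exact hstep q.2 (hmax q (hM.sub hq)) (hM.reachM q hq)
      · intro C hC hmat hcov hcard c hc
        by_cases hKC : K ∈ C
        · obtain ⟨C', h1, h2, h3, h4, h5⟩ := hwithK C hC hmat hcov hKC
          exact ⟨C', h1, h2, h3, le_antisymm (h4.trans hcard.le) (iw_le h1 h2 h3), K, h5,
            hmax' c (hC hc)⟩
        · have hCF := hsubF C hC hKC
          have := hM.low C hCF hmat hcov
          exact hstep c.2 (hmax' c (hC hc))
            (hM.reachC C hCF hmat hcov (by omega) c hc)
    · -- K is added to M
      have hKr : ¬ Reach F K.1 := fun h => hn (hreach_le h)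
      obtain ⟨C1, hC1, hmat1, hcov1, hcard1⟩ := iw_spec F hF0
      have hno : ∀ c ∈ C1, ¬ Meets K c := fun c hc hm =>
        hKr ⟨C1, hC1, hmat1, hcov1, hcard1, c, hc, (hmeet c (hC1 hc)).1 hm⟩
      have hKC1 : K ∉ C1 := fun h => hK (hC1 h)
      have hA1 : insert K C1 ⊆ insert K F := Finset.insert_subset_insert _ hC1
      have hA2 : IntMatching (insert K C1) := matching_insert hmat1 hno
      have hA3 : IntCovers (insert K C1) (insert K F) := by
        intro p hp
        rcases Finset.mem_insert.1 hp with rfl | hp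
        · exact ⟨p, Finset.mem_insert_self _ _, hKK⟩
        · obtain ⟨q, hq, hm⟩ := hcov1 p hp
          exact ⟨q, Finset.mem_insert_of_mem hq, hm⟩
      have hA4 : (insert K C1).card = iw F + 1 := by
        rw [Finset.card_insert_of_notMem hKC1, hcard1]
      have hA5 := iw_le hA1 hA2 hA3
      have hreach : ∀ t ≤ K.2, Reach (insert K F) t := fun t ht =>
        ⟨insert K C1, hA1, hA2, hA3, by omega, K, Finset.mem_insert_self _ _, ht⟩
      have hsubM : insert K M ⊆ insert K F := Finset.insert_subset_insert _ hM.sub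
      have hlow : ∀ C ⊆ insert K F, IntMatching C → IntCovers C (insert K M) →
          iw (insert K F) ≤ C.card := by
        intro C hC hmat hcov
        have hcovM : IntCovers C M := fun p hp => hcov p (Finset.mem_insert_of_mem hp)
        by_cases hKC : K ∈ C
        · obtain ⟨C', h1, h2, h3, h4, _⟩ := hwithK C hC hmat hcovM hKC
          exact (iw_le h1 h2 h3).trans h4
        · have hCF := hsubF C hC hKC
          have h1 := hM.low C hCF hmat hcovM
          by_contra hlt
          obtain ⟨c, hc, hm⟩ := hcov K (Finset.mem_insert_self _ _)
          have h2 := (hmeet c (hCF hc)).1 hm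
          obtain ⟨D, d1, d2, d3, d4, d, hd, hcd⟩ :=
            hM.reachC C hCF hmat hcovM (by omega) c hc
          exact hKr ⟨D, d1, d2, d3, d4, d, hd, h2.trans hcd⟩
      refine ⟨insert K M, hsubM, ?_, hlow, hlowz _ hsubM ?_ hlow, ?_, ?_⟩
      · apply matching_insert hM.mat
        intro q hq hm
        have h2 := (hmeet q (hM.sub hq)).1 hm
        obtain ⟨D, d1, d2, d3, d4, d, hd, hcd⟩ := hM.reachM q hq
        exact hKr ⟨D, d1, d2, d3, d4, d, hd, h2.trans hcd⟩
      · intro p hp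
        simp [hp]
      · intro q hq
        exact hreach _ (hmax' q (hsubM hq))
      · intro C hC _ _ _ c hc
        exact hreach _ (hmax' c (hC hc))

theorem stmt11 (F : Finset (ℝ × ℝ)) (hF : ∀ p ∈ F, p.1 ≤ p.2) :
    imw F = iw F ∧
    ∃ M ⊆ F, IntMatching M ∧
      ∀ C ⊆ F, IntMatching C → IntCovers C M → iw F ≤ C.card := by
  obtain ⟨M, hM⟩ := main_inv F hF
  refine ⟨?_, M, hM.sub, hM.mat, hM.low⟩
  obtain ⟨C, hC, hmat, hcov, hcard⟩ := iw_spec F hF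
  have hle : ∀ N ⊆ F, iwRel N F ≤ iw F := fun N hN => by
    rw [← hcard]
    exact iwRel_le hC hmat (fun p hp => hcov p (hN hp))
  have heq : iwRel M F = iw F := by
    apply le_antisymm (hle M hM.sub)
    have hne : {n | ∃ C ⊆ F, IntMatching C ∧ IntCovers C M ∧ C.card = n}.Nonempty :=
      ⟨C.card, C, hC, hmat, fun p hp => hcov p (hM.sub hp), rfl⟩
    obtain ⟨D, d1, d2, d3, d4⟩ := Nat.sInf_mem hne
    calc iw F ≤ D.card := hM.low D d1 d2 d3
      _ = iwRel M F := d4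
  have hG : IsGreatest {n | ∃ M ⊆ F, IntMatching M ∧ iwRel M F = n} (iw F) := by
    refine ⟨⟨M, hM.sub, hM.mat, heq⟩, ?_⟩
    rintro n ⟨N, hN, _, rfl⟩
    exact hle N hN
  exact hG.csSup_eq
end

section
/- For every finite point-tree hypergraph H, σ(H) ≤ ν(H). That is, if each edge e ∈ H has the form {x(e)} ∪ V(t(e)) where x(e) ∈ X and t(e) is a subtree of a fixed tree T (with V(T) disjoint from X), then H admits a covering consisting of at most ν(H) elements, each being either a singleton {x(e)} or a tree vertex set V(t(e)) for some e ∈ H. -/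
/-- `s` is a subtree of the tree `T`: nonempty and inducing a connected subgraph. -/
def IsSubtree {W : Type*} (T : SimpleGraph W) (s : Finset W) : Prop :=
  s.Nonempty ∧ (T.induce (s : Set W)).Connected

/-- Two point-tree edges `(x, s)`, `(y, u)` are disjoint: they share neither
the point nor a tree vertex. -/
def PTDisjoint {X W : Type*} [DecidableEq W] (e f : X × Finset W) : Prop :=
  e.1 ≠ f.1 ∧ Disjoint e.2 f.2

/-- `ν(H)`: maximal size of a set of pairwise disjoint edges of `H`. -/
noncomputable def ptNu {X W : Type*} [DecidableEq W] (H : Finset (X × Finset W)) : ℕ :=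
  sSup {n | ∃ M ⊆ H, (∀ e ∈ M, ∀ f ∈ M, e ≠ f → PTDisjoint e f) ∧ M.card = n}


theorem tree_parent {W : Type*} (T : SimpleGraph W) (hT : T.IsTree) :
    ∃ (d : W → ℕ) (p : W → W), ∀ s : Set W, (T.induce s).Connected →
      ∀ u ∈ s, ∀ x ∈ s, x ≠ u → d x ≤ d u → p u ∈ s ∧ d (p u) < d u := by
  classical
  have := hT.connected.nonempty
  inhabit W
  choose f hf hf' using (hT.existsUnique_path · default)
  refine ⟨fun u => (f u).length, fun u => (f u).snd, ?_⟩
  intro s hs u hu x hx hxu hd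
  have hdrop : ∀ a b (h : b ∈ (f a).support), (f a).dropUntil b h = f b := fun a b h =>
    hf' b _ ((hf a).dropUntil h)
  have hxD : u ∉ (f x).support := by
    intro h
    have h1 := hdrop x u h
    have h2 := congrArg SimpleGraph.Walk.length ((f x).take_spec h)
    rw [SimpleGraph.Walk.length_append, h1] at h2
    have h3 : ((f x).takeUntil u h).length ≠ 0 := by
      intro h0
      exact hxu (SimpleGraph.Walk.eq_of_length_eq_zero h0)
    simp only at hd
    omega
  obtain ⟨w⟩ := hs.preconnected ⟨u, hu⟩ ⟨x, hx⟩
  obtain ⟨e, -, h1, h2⟩ := w.exists_boundary_dart {y : s | u ∈ (f y.1).support} (by simp) hxD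
  obtain ⟨⟨⟨y, hy⟩, ⟨y', hy'⟩⟩, hadj⟩ := e
  simp only [Set.mem_ofPred_eq] at h1 h2
  have hadj' : T.Adj y y' := by simpa using hadj
  by_cases hc : y ∈ (f y').support
  · exfalso
    apply h2
    rw [← hdrop y' y hc] at h1
    exact (f y').support_dropUntil_subset_support hc h1
  · have hp := hf' y _ ((hf y').cons (h := hadj') hc)
    rw [← hp] at h1
    simp only [SimpleGraph.Walk.support_cons, List.mem_cons] at h1
    rcases h1 with rfl | h1
    · have h3 : (f u).snd = y' := by rw [← hp]; simp
      have h4 : (f u).length = (f y').length + 1 := by rw [← hp]; simp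
      refine ⟨by simp only [h3]; exact hy', ?_⟩
      change (f (f u).snd).length < (f u).length
      rw [h3]
      omega
    · exact absurd h1 h2

section chains
variable {V : Type*} [Fintype V] [DecidableEq V]

/-- mod 2 boundary -/
def bdry (z : Finset V → ZMod 2) : Finset V → ZMod 2 :=
  fun t => ∑ v ∈ tᶜ, z (insert v t)

/-- join with a vertex -/
def vjoin (w : V) (c : Finset V → ZMod 2) : Finset V → ZMod 2 :=
  fun s => if w ∈ s then c (s.erase w) else 0

theorem z2_add_self (a : ZMod 2) : a + a = 0 := CharTwo.add_self_eq_zero a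

theorem bdry_add (y z : Finset V → ZMod 2) : bdry (y + z) = bdry y + bdry z := by
  funext t
  simp [bdry, Finset.sum_add_distrib]

theorem bdry_sum {ι : Type*} (s : Finset ι) (z : ι → Finset V → ZMod 2) :
    bdry (∑ i ∈ s, z i) = ∑ i ∈ s, bdry (z i) := by
  funext t
  simp only [bdry, Finset.sum_apply]
  rw [Finset.sum_comm]

theorem bdry_bdry (z : Finset V → ZMod 2) : bdry (bdry z) = 0 := by
  funext t
  simp only [bdry, Pi.zero_apply]
  rw [Finset.sum_sigma']
  refine Finset.sum_involution (fun a _ => ⟨a.2, a.1⟩) ?_ ?_ ?_ ?_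
  · rintro ⟨a, b⟩ h
    simp only [Finset.insert_comm a b]
    exact z2_add_self _
  · rintro ⟨a, b⟩ h h' h2
    simp at h h2
    grind
  · rintro ⟨a, b⟩ h
    simp at h ⊢
    grind
  · rintro ⟨a, b⟩ h
    rfl

theorem bdry_pair (g y : Finset V → ZMod 2) :
    ∑ t, g t * bdry y t = ∑ s, y s * ∑ v ∈ s, g (s.erase v) := by
  simp only [bdry, Finset.mul_sum]
  rw [Finset.sum_sigma', Finset.sum_sigma']
  refine Finset.sum_bij' (fun a _ => ⟨insert a.2 a.1, a.2⟩) (fun a _ => ⟨a.1.erase a.2, a.2⟩)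
    ?_ ?_ ?_ ?_ ?_
  · rintro ⟨a, b⟩ h; simp
  · rintro ⟨a, b⟩ h; simp
  · rintro ⟨a, b⟩ h; simp at h; simp [h]
  · rintro ⟨a, b⟩ h; simp at h; simp [h]
  · rintro ⟨a, b⟩ h; simp at h; simp [h, mul_comm]

theorem bdry_vjoin (w : V) (c : Finset V → ZMod 2) (hc : ∀ s, w ∈ s → c s = 0) (t : Finset V) :
    bdry (vjoin w c) t = if w ∈ t then bdry c (t.erase w) else c t := by
  simp only [bdry, vjoin]
  split_ifs with h
  · have : (t.erase w)ᶜ = insert w tᶜ := by simp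
    rw [this, Finset.sum_insert (by simpa using h)]
    rw [hc _ (by simp), zero_add]
    refine Finset.sum_congr rfl fun v hv => ?_
    have : v ≠ w := by rintro rfl; simp at hv; exact hv h
    rw [if_pos (by simp [h]), Finset.erase_insert_of_ne this]
  · rw [Finset.sum_eq_single w]
    · simp [h]
    · intro b _ hb
      rw [if_neg]
      simp [h, hb.symm]
    · simp [h]

/-- link part -/
def lk (w : V) (z : Finset V → ZMod 2) : Finset V → ZMod 2 :=
  fun s => if w ∈ s then 0 else z (insert w s)

theorem bdry_lk (w : V) (z : Finset V → ZMod 2) (hz : bdry z = 0) : bdry (lk w z) = 0 := by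
  funext t
  simp only [bdry, lk, Pi.zero_apply]
  by_cases h : w ∈ t
  · exact Finset.sum_eq_zero fun v _ => by simp [h]
  · have h1 := congrFun hz (insert w t)
    simp only [bdry, Pi.zero_apply] at h1
    refine Eq.trans ?_ h1
    have : tᶜ = insert w (insert w t)ᶜ := by ext; simp; grind
    rw [this, Finset.sum_insert (by simp)]
    simp only [Finset.mem_insert, true_or, if_true, zero_add]
    refine Finset.sum_congr rfl fun v hv => ?_
    simp at hv
    rw [if_neg (by simp [h]; grind), Finset.insert_comm]

theorem bdry_dl (w : V) (z : Finset V → ZMod 2) (hz : bdry z = 0) :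
    bdry (fun s => if w ∈ s then 0 else z s) = lk w z := by
  funext t
  simp only [bdry, lk]
  split_ifs with h
  · exact Finset.sum_eq_zero fun v _ => by simp [h]
  · have h1 := congrFun hz t
    simp only [bdry, Pi.zero_apply] at h1
    have : w ∈ tᶜ := by simpa using h
    rw [← Finset.add_sum_erase _ _ this] at h1 ⊢
    simp only [Finset.mem_insert, true_or, if_true, zero_add]
    rw [← CharTwo.add_eq_zero, ← h1, add_comm]
    congr 1
    refine Finset.sum_congr rfl fun v hv => ?_
    simp at hv
    rw [if_neg (by simp [h]; grind)]

theorem corr_eq (w : V) (z c : Finset V → ZMod 2)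
    (hc : ∀ s, w ∈ s → c s = 0) (hb : bdry c = lk w z) (s : Finset V) :
    (z + bdry (vjoin w c)) s = if w ∈ s then 0 else z s + c s := by
  rw [Pi.add_apply, bdry_vjoin w c hc, hb]
  split_ifs with h
  · simp [lk, h, z2_add_self]
  · rfl

/-- independent sets -/
def RInd (R : V → V → Prop) (s : Finset V) : Prop := ∀ u ∈ s, ∀ v ∈ s, u ≠ v → ¬ R u v

/-- `D` dominates `U` -/
def RDom (R : V → V → Prop) (D U : Finset V) : Prop := ∀ u ∈ U, ∃ d ∈ D, R d u

theorem acyclic (R : V → V → Prop) (hr : ∀ v, R v v) (hs : ∀ u v, R u v → R v u)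
    (hsimp : ∀ U : Finset V, U.Nonempty → ∃ e ∈ U, ∀ a ∈ U, ∀ b ∈ U, R e a → R e b → R a b) :
    ∀ (n : ℕ) (U : Finset V) (k : ℕ), U.card = n → (∀ D ⊆ U, RDom R D U → k ≤ D.card) →
    ∀ z : Finset V → ZMod 2, bdry z = 0 →
      (∀ s, z s ≠ 0 → RInd R s ∧ s ⊆ U ∧ s.card < k) →
      ∃ y : Finset V → ZMod 2, bdry y = z ∧
        ∀ s, y s ≠ 0 → RInd R s ∧ s ⊆ U ∧ s.card < k + 1 := by
  classical
  intro n
  induction n using Nat.strong_induction_on with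
  | _ n ih =>
  intro U k hn hk z hz hsupp
  rcases U.eq_empty_or_nonempty with rfl | hU
  · have hk0 : k = 0 := by simpa using hk ∅ (by simp) (by intro u hu; simp at hu)
    refine ⟨0, ?_, by simp⟩
    funext s
    by_contra h
    have := (hsupp s (fun h' => h (by rw [h']; simp [bdry]))).2.2
    omega
  obtain ⟨e, he, hse⟩ := hsimp U hU
  have hjoin : ∀ w ∈ U, ∀ c : Finset V → ZMod 2,
      (∀ s, c s ≠ 0 → RInd R s ∧ s ⊆ U.filter (fun u => ¬ R w u) ∧ s.card < k) →
      ∀ s, vjoin w c s ≠ 0 → RInd R s ∧ s ⊆ U ∧ s.card < k + 1 := by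
    intro w hw c hc s h
    simp only [vjoin] at h
    split_ifs at h with hws
    · obtain ⟨h1, h2, h3⟩ := hc _ h
      refine ⟨?_, ?_, ?_⟩
      · intro a ha b hb hab
        have key : ∀ x ∈ s, x ≠ w → ¬ R w x := fun x hx hxw => by
          have := h2 (Finset.mem_erase.2 ⟨hxw, hx⟩)
          simp at this
          exact this.2
        by_cases haw : a = w
        · subst haw; exact key b hb hab.symm
        · by_cases hbw : b = w
          · subst hbw; exact fun h => key a ha hab (hs _ _ h)
          · exact h1 a (by simp [*]) b (by simp [*]) hab
      · intro a ha
        by_cases haw : a = w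
        · subst haw; exact hw
        · have := h2 (Finset.mem_erase.2 ⟨haw, ha⟩)
          simp at this
          exact this.1
      · have := Finset.card_erase_add_one hws
        omega
    · exact absurd rfl h
  by_cases hw : ∃ w ∈ U, w ≠ e ∧ R e w
  · obtain ⟨w, hwU, hwe, hRw⟩ := hw
    set N := U.filter (fun u => ¬ R w u) with hN
    have hNc : N.card < n := by
      rw [← hn]
      refine Finset.card_lt_card (Finset.filter_ssubset.2 ⟨w, hwU, by simpa using hr w⟩)
    have hlks : ∀ s, lk w z s ≠ 0 → RInd R s ∧ s ⊆ N ∧ s.card < k - 1 := by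
      intro s h
      simp only [lk] at h
      split_ifs at h with hws
      · exact absurd rfl h
      · obtain ⟨h1, h2, h3⟩ := hsupp _ h
        rw [Finset.card_insert_of_notMem hws] at h3
        refine ⟨fun a ha b hb => h1 a (by simp [ha]) b (by simp [hb]), ?_, by omega⟩
        intro a ha
        rw [hN, Finset.mem_filter]
        exact ⟨h2 (by simp [ha]), h1 w (by simp) a (by simp [ha]) (by rintro rfl; exact hws ha)⟩
    obtain ⟨c, hc, hcs⟩ := ih _ hNc N (k - 1) rfl (by
      intro D hD hdom
      have := hk (insert w D) (by
        intro a ha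
        rcases Finset.mem_insert.1 ha with rfl | ha
        · exact hwU
        · exact (Finset.mem_filter.1 (hD ha)).1) (by
        intro u hu
        by_cases h : R w u
        · exact ⟨w, by simp, h⟩
        · obtain ⟨d, hd, h'⟩ := hdom u (by rw [hN, Finset.mem_filter]; exact ⟨hu, h⟩)
          exact ⟨d, by simp [hd], h'⟩)
      have := Finset.card_insert_le w D
      omega) (lk w z) (bdry_lk w z hz) hlks
    -- need k ≥ 1
    have hk1 : 1 ≤ k ∨ k = 0 := by omega
    rcases hk1 with hk1 | hk0
    swap
    · refine ⟨0, ?_, by simp⟩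
      funext s
      by_contra h
      have := (hsupp s (fun h' => h (by rw [h']; simp [bdry]))).2.2
      omega
    have hcs' : ∀ s, c s ≠ 0 → RInd R s ∧ s ⊆ N ∧ s.card < k := fun s h => by
      have := hcs s h
      exact ⟨this.1, this.2.1, by omega⟩
    have hcw : ∀ s, w ∈ s → c s = 0 := by
      intro s hws
      by_contra h
      have := (hcs s h).2.1 hws
      rw [hN, Finset.mem_filter] at this
      exact this.2 (hr w)
    have hY := corr_eq w z c hcw hc
    obtain ⟨y, hy, hys⟩ := ih (U.erase w).card
      (by rw [← hn]; exact Finset.card_erase_lt_of_mem hwU) (U.erase w) k rfl (by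
        intro D hD hdom
        refine hk D (hD.trans (Finset.erase_subset _ _)) ?_
        intro u hu
        by_cases huw : u = w
        · subst huw
          obtain ⟨d, hd, hde⟩ := hdom e (by simp [he, hwe.symm])
          exact ⟨d, hd, hse d (Finset.mem_of_mem_erase (hD hd)) u hu (hs _ _ hde) hRw⟩
        · exact hdom u (by simp [hu, huw]))
      (z + bdry (vjoin w c)) (by rw [bdry_add, hz, bdry_bdry, add_zero]) (by
        intro s h
        rw [hY] at h
        split_ifs at h with hws
        · exact absurd rfl h
        · have : z s ≠ 0 ∨ c s ≠ 0 := by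
            by_contra h'
            push Not at h'
            exact h (by rw [h'.1, h'.2, add_zero])
          rcases this with h | h
          · obtain ⟨h1, h2, h3⟩ := hsupp s h
            exact ⟨h1, Finset.subset_erase.2 ⟨h2, hws⟩, h3⟩
          · obtain ⟨h1, h2, h3⟩ := hcs' s h
            exact ⟨h1, Finset.subset_erase.2 ⟨h2.trans (Finset.filter_subset _ _), hws⟩, h3⟩)
    refine ⟨y + vjoin w c, ?_, ?_⟩
    · rw [bdry_add, hy, add_assoc]
      funext s
      simp [z2_add_self]
    · intro s h
      have : y s ≠ 0 ∨ vjoin w c s ≠ 0 := by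
        by_contra h'
        push Not at h'
        exact h (by rw [Pi.add_apply, h'.1, h'.2, add_zero])
      rcases this with h | h
      · obtain ⟨h1, h2, h3⟩ := hys s h
        exact ⟨h1, h2.trans (Finset.erase_subset _ _), h3⟩
      · exact hjoin w hwU c hcs' s h
  · push Not at hw
    set c : Finset V → ZMod 2 := fun s => if e ∈ s then 0 else z s with hc
    have hY := corr_eq e z c (by intro s h; simp [hc, h]) (bdry_dl e z hz)
    refine ⟨vjoin e c, ?_, ?_⟩
    · funext s
      have := hY s
      have h0 : (if e ∈ s then 0 else z s + c s) = 0 := by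
        split_ifs with h
        · rfl
        · simp [hc, h, z2_add_self]
      rw [h0, Pi.add_apply] at this
      exact (CharTwo.add_eq_zero.1 this).symm
    · apply hjoin e he
      intro s h
      simp only [hc] at h
      split_ifs at h with hes
      · exact absurd rfl h
      · obtain ⟨h1, h2, h3⟩ := hsupp s h
        refine ⟨h1, ?_, h3⟩
        intro a ha
        rw [Finset.mem_filter]
        exact ⟨h2 ha, hw a (h2 ha) (by rintro rfl; exact hes ha)⟩

/-- `s` is rainbow onto `τ` -/
def Rb {X : Type*} [DecidableEq X] (c : V → X) (s : Finset V) (τ : Finset X) : Prop :=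
  s.image c = τ ∧ s.card = τ.card

theorem Rb.injOn {X : Type*} [DecidableEq X] {c : V → X} {s : Finset V} {τ : Finset X}
    (h : Rb c s τ) : Set.InjOn c (s : Set V) := by
  rw [← Finset.card_image_iff, h.1, h.2]

open Classical in
theorem rb_parity {X : Type*} [DecidableEq X] (c : V → X) (s : Finset V) (σ : Finset X) (x : X)
    (hx : x ∈ σ) (hsσ : s.image c ⊆ σ) :
    ∑ v ∈ s, (if Rb c (s.erase v) (σ.erase x) then (1 : ZMod 2) else 0)
      = if Rb c s σ then 1 else 0 := by
  split_ifs with h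
  · have hinj := h.injOn
    obtain ⟨v0, hv0, rfl⟩ := Finset.mem_image.1 (h.1 ▸ hx)
    rw [Finset.sum_eq_single v0]
    · rw [if_pos]
      refine ⟨?_, ?_⟩
      · ext y
        rw [← h.1]
        simp only [Finset.mem_image, Finset.mem_erase]
        constructor
        · rintro ⟨a, ⟨ha, has⟩, rfl⟩
          exact ⟨fun hh => ha (hinj has hv0 hh), a, has, rfl⟩
        · rintro ⟨hy, a, ha, rfl⟩
          exact ⟨a, ⟨fun hh => hy (by rw [hh]), ha⟩, rfl⟩
      · rw [Finset.card_erase_of_mem hv0, Finset.card_erase_of_mem hx, h.2]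
    · intro b hb hbv
      rw [if_neg]
      intro h'
      have : c v0 ∈ (s.erase b).image c :=
        Finset.mem_image_of_mem _ (Finset.mem_erase.2 ⟨hbv.symm, hv0⟩)
      rw [h'.1] at this
      simp at this
    · intro h'; exact absurd hv0 h'
  · by_cases hex : ∃ v ∈ s, Rb c (s.erase v) (σ.erase x)
    · obtain ⟨v1, hv1, hr⟩ := hex
      have hcard : s.card = σ.card := by
        have := hr.2
        have h1 := Finset.card_erase_add_one hv1
        have h2 := Finset.card_erase_add_one hx
        omega
      have hne : c v1 ≠ x := by
        intro hh
        apply h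
        refine ⟨?_, hcard⟩
        rw [← Finset.insert_erase hv1, Finset.image_insert, hr.1, hh, Finset.insert_erase hx]
      have hmem : c v1 ∈ (s.erase v1).image c := by
        rw [hr.1]
        exact Finset.mem_erase.2 ⟨hne, hsσ (Finset.mem_image_of_mem _ hv1)⟩
      obtain ⟨v2, hv2, hc2⟩ := Finset.mem_image.1 hmem
      obtain ⟨h21, hv2s⟩ := Finset.mem_erase.1 hv2
      have hr2 : Rb c (s.erase v2) (σ.erase x) := by
        refine ⟨?_, ?_⟩
        · rw [← hr.1]
          ext y
          simp only [Finset.mem_image, Finset.mem_erase]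
          constructor
          · rintro ⟨a, ⟨ha, has⟩, rfl⟩
            by_cases ha1 : a = v1
            · exact ⟨v2, ⟨h21, hv2s⟩, by rw [ha1, hc2]⟩
            · exact ⟨a, ⟨ha1, has⟩, rfl⟩
          · rintro ⟨a, ⟨ha, has⟩, rfl⟩
            by_cases ha1 : a = v2
            · exact ⟨v1, ⟨h21.symm, hv1⟩, by rw [ha1, hc2]⟩
            · exact ⟨a, ⟨ha1, has⟩, rfl⟩
        · rw [Finset.card_erase_of_mem hv2s, Finset.card_erase_of_mem hx, hcard]
      have hsub : ({v1, v2} : Finset V) ⊆ s := by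
        intro a ha
        simp at ha
        rcases ha with rfl | rfl <;> assumption
      rw [← Finset.sum_subset hsub, Finset.sum_pair h21.symm, if_pos hr, if_pos hr2]
      · exact z2_add_self 1
      · intro v hv hv'
        simp at hv'
        rw [if_neg]
        intro h'
        exact h21 (h'.injOn (by simp [hv2s, Ne.symm hv'.2])
          (by simp [hv1, Ne.symm hv'.1]) hc2)
    · push Not at hex
      exact Finset.sum_eq_zero fun v hv => if_neg (hex v hv)

theorem rainbow {X : Type*} [DecidableEq X] (R : V → V → Prop) (hr : ∀ v, R v v)
    (hs : ∀ u v, R u v → R v u)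
    (hsimp : ∀ U : Finset V, U.Nonempty → ∃ e ∈ U, ∀ a ∈ U, ∀ b ∈ U, R e a → R e b → R a b)
    (c : V → X) (S : Finset X)
    (hdom : ∀ σ ⊆ S, ∀ D ⊆ Finset.univ.filter (fun v => c v ∈ σ),
      RDom R D (Finset.univ.filter (fun v => c v ∈ σ)) → σ.card ≤ D.card) :
    ∃ s : Finset V, RInd R s ∧ Rb c s S := by
  classical
  have main : ∀ n : ℕ, ∃ φ : Finset X → Finset V → ZMod 2, ∀ σ ⊆ S, σ.card ≤ n →
      (∀ s, φ σ s ≠ 0 → RInd R s ∧ s ⊆ Finset.univ.filter (fun v => c v ∈ σ) ∧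
        s.card < σ.card + 1) ∧
      bdry (φ σ) = ∑ x ∈ σ, φ (σ.erase x) ∧
      ∑ s, (if Rb c s σ then (1 : ZMod 2) else 0) * φ σ s = 1 := by
    intro n
    induction n with
    | zero =>
      refine ⟨fun _ s => if s = ∅ then 1 else 0, ?_⟩
      intro σ _ hc
      obtain rfl : σ = ∅ := by simpa using hc
      refine ⟨?_, ?_, ?_⟩
      · intro s h
        have : s = ∅ := by by_contra h'; simp [h'] at h
        subst this
        simp [RInd]
      · funext t
        simp [bdry]
      · simp [Rb]
    | succ n ih =>
      obtain ⟨φ, hφ⟩ := ih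
      have hstep : ∀ σ : Finset X, ∃ y : Finset V → ZMod 2, σ ⊆ S → σ.card = n + 1 →
          bdry y = ∑ x ∈ σ, φ (σ.erase x) ∧
          ∀ s, y s ≠ 0 → RInd R s ∧ s ⊆ Finset.univ.filter (fun v => c v ∈ σ) ∧
            s.card < σ.card + 1 := by
        intro σ
        by_cases hσ : σ ⊆ S ∧ σ.card = n + 1
        swap
        · exact ⟨0, fun h1 h2 => absurd ⟨h1, h2⟩ hσ⟩
        obtain ⟨hσS, hσn⟩ := hσ
        have hsub : ∀ x ∈ σ, σ.erase x ⊆ S ∧ (σ.erase x).card = n := fun x hx =>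
          ⟨(Finset.erase_subset _ _).trans hσS, by rw [Finset.card_erase_of_mem hx]; omega⟩
        obtain ⟨y, h1, h2⟩ := acyclic R hr hs hsimp _ (Finset.univ.filter (fun v => c v ∈ σ))
          σ.card rfl (hdom σ hσS) (∑ x ∈ σ, φ (σ.erase x)) (by
            rw [bdry_sum]
            rw [Finset.sum_congr rfl (fun x hx =>
              (hφ _ (hsub x hx).1 (hsub x hx).2.le).2.1)]
            rw [Finset.sum_sigma']
            refine Finset.sum_involution (fun a _ => ⟨a.2, a.1⟩) ?_ ?_ ?_ ?_
            · rintro ⟨a, b⟩ h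
              simp only [Finset.erase_right_comm (a := a) (b := b)]
              funext t
              exact z2_add_self _
            · rintro ⟨a, b⟩ h h' h2
              simp at h h2
              grind
            · rintro ⟨a, b⟩ h
              simp at h ⊢
              grind
            · rintro ⟨a, b⟩ h
              rfl) (by
            intro s h
            rw [Finset.sum_apply] at h
            obtain ⟨x, hx, h⟩ := Finset.exists_ne_zero_of_sum_ne_zero h
            obtain ⟨h1, h2, h3⟩ := (hφ _ (hsub x hx).1 (hsub x hx).2.le).1 s h
            refine ⟨h1, fun a ha => ?_, ?_⟩
            · have := h2 ha
              simp at this ⊢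
              exact this.2
            · rw [(hsub x hx).2] at h3
              omega)
        exact ⟨y, fun _ _ => ⟨h1, h2⟩⟩
      choose g hg using hstep
      refine ⟨fun σ => if σ.card = n + 1 then g σ else φ σ, ?_⟩
      intro σ hσS hσn
      by_cases hσ : σ.card = n + 1
      swap
      · have h1 : ∀ x ∈ σ, (σ.erase x).card ≠ n + 1 := fun x hx => by
          rw [Finset.card_erase_of_mem hx]; omega
        simp only [hσ, if_false]
        rw [Finset.sum_congr rfl (fun x hx => if_neg (h1 x hx))]
        exact hφ σ hσS (by omega)
      · have h1 : ∀ x ∈ σ, (σ.erase x).card ≠ n + 1 := fun x hx => by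
          rw [Finset.card_erase_of_mem hx]; omega
        rw [Finset.sum_congr rfl (fun x hx => if_neg (h1 x hx))]
        simp only [hσ, if_true]
        obtain ⟨hb, hsup⟩ := hg σ hσS hσ
        refine ⟨by rw [← hσ]; exact hsup, hb, ?_⟩
        obtain ⟨x, hx⟩ : σ.Nonempty := by rw [← Finset.card_pos]; omega
        have hτ := hφ (σ.erase x) ((Finset.erase_subset _ _).trans hσS)
          (by rw [Finset.card_erase_of_mem hx]; omega)
        refine Eq.trans ?_ hτ.2.2
        have hp := bdry_pair (fun s => if Rb c s (σ.erase x) then (1 : ZMod 2) else 0) (g σ)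
        have e1 : ∑ s, g σ s * ∑ v ∈ s, (if Rb c (s.erase v) (σ.erase x) then (1 : ZMod 2) else 0)
            = ∑ s, (if Rb c s σ then (1 : ZMod 2) else 0) * g σ s := by
          refine Finset.sum_congr rfl fun s _ => ?_
          by_cases h0 : g σ s = 0
          · simp [h0]
          · rw [rb_parity c s σ x hx, mul_comm]
            intro a ha
            obtain ⟨v, hv, rfl⟩ := Finset.mem_image.1 ha
            have := (hsup s h0).2.1 hv
            simpa using this
        rw [← e1, ← hp, hb]
        refine Finset.sum_congr rfl fun s _ => ?_
        by_cases hrb : Rb c s (σ.erase x)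
        · congr 1
          rw [Finset.sum_apply, Finset.sum_eq_single x]
          · intro y hy hyx
            by_contra h
            have h2 := ((hφ (σ.erase y) ((Finset.erase_subset _ _).trans hσS)
              (by rw [Finset.card_erase_of_mem hy]; omega)).1 s h).2.1
            have : y ∈ s.image c := by rw [hrb.1]; simp [hy, hyx]
            obtain ⟨v, hv, rfl⟩ := Finset.mem_image.1 this
            have := h2 hv
            simp at this
          · intro h; exact absurd hx h
        · simp [hrb]
  obtain ⟨φ, hφ⟩ := main S.card
  obtain ⟨h1, -, h3⟩ := hφ S subset_rfl le_rfl
  obtain ⟨s, -, h⟩ := Finset.exists_ne_zero_of_sum_ne_zero (h3.trans_ne one_ne_zero)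
  have hrb : Rb c s S := by
    by_contra h'
    simp [h'] at h
  exact ⟨s, (h1 s (right_ne_zero_of_mul h)).1, hrb⟩

end chains

theorem simplicial_exists {X W : Type*} [DecidableEq X] [DecidableEq W]
    (T : SimpleGraph W) (hT : T.IsTree) (H : Finset (X × Finset W))
    (htrees : ∀ e ∈ H, IsSubtree T e.2) (U : Finset H) (hU : U.Nonempty) :
    ∃ e ∈ U, ∀ a ∈ U, ∀ b ∈ U, (e.1.2 ∩ a.1.2).Nonempty → (e.1.2 ∩ b.1.2).Nonempty →
      (a.1.2 ∩ b.1.2).Nonempty := by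
  obtain ⟨d, p, hdp⟩ := tree_parent T hT
  have hmin : ∀ e : H, ∃ v ∈ e.1.2, ∀ u ∈ e.1.2, d v ≤ d u := fun e =>
    Finset.exists_min_image e.1.2 d (htrees e.1 e.2).1
  choose m hm hm' using hmin
  obtain ⟨e, he, hmax⟩ := Finset.exists_max_image U (fun e => d (m e)) hU
  have hdp' : ∀ (a : H), ∀ u ∈ a.1.2, ∀ x ∈ a.1.2, x ≠ u → d x ≤ d u →
      p u ∈ a.1.2 ∧ d (p u) < d u := fun a u hu x hx =>
    hdp _ (htrees a.1 a.2).2 u hu x hx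
  have key : ∀ a ∈ U, (e.1.2 ∩ a.1.2).Nonempty → m e ∈ a.1.2 := by
    intro a ha hne
    obtain ⟨u, hu, humin⟩ := Finset.exists_min_image _ d hne
    obtain ⟨hue, hua⟩ := Finset.mem_inter.1 hu
    by_cases h1 : m e = u
    · rw [h1]; exact hua
    exfalso
    obtain ⟨hpe, hlt⟩ := hdp' e u hue (m e) (hm e) h1 (hm' e u hue)
    have h2 : m a ≠ u := by
      rintro rfl
      have := hmax a ha
      have := hm' e _ hpe
      omega
    obtain ⟨hpa, -⟩ := hdp' a u hua (m a) (hm a) h2 (hm' a u hua)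
    have := humin (p u) (Finset.mem_inter.2 ⟨hpe, hpa⟩)
    omega
  exact ⟨e, he, fun a ha b hb h1 h2 => ⟨m e, Finset.mem_inter.2 ⟨key a ha h1, key b hb h2⟩⟩⟩

/-- conflict relation with `d` dummy cliques added -/
def conflict {X W : Type*} [DecidableEq W] (H : Finset (X × Finset W)) (d : ℕ) :
    H ⊕ (Fin d × X) → H ⊕ (Fin d × X) → Prop
  | Sum.inl a, Sum.inl b => (a.1.2 ∩ b.1.2).Nonempty
  | Sum.inr a, Sum.inr b => a.1 = b.1
  | _, _ => False

theorem stmt12 {X W : Type*} [Fintype X] [Fintype W] [DecidableEq X] [DecidableEq W]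
    (T : SimpleGraph W) (hT : T.IsTree)
    (H : Finset (X × Finset W))
    (htrees : ∀ e ∈ H, IsSubtree T e.2) :
    ∃ C : Finset (X ⊕ Finset W),
      (∀ c ∈ C, (∃ e ∈ H, c = Sum.inl e.1) ∨ (∃ e ∈ H, c = Sum.inr e.2)) ∧
      (∀ e ∈ H, ∃ c ∈ C,
        c = Sum.inl e.1 ∨ ∃ s : Finset W, c = Sum.inr s ∧ (s ∩ e.2).Nonempty) ∧
      C.card ≤ ptNu H := by
  classical
  by_contra hcon
  have hcov : ∀ C : Finset (X ⊕ Finset W),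
      (∀ c ∈ C, (∃ e ∈ H, c = Sum.inl e.1) ∨ (∃ e ∈ H, c = Sum.inr e.2)) →
      (∀ e ∈ H, ∃ c ∈ C,
        c = Sum.inl e.1 ∨ ∃ s : Finset W, c = Sum.inr s ∧ (s ∩ e.2).Nonempty) →
      ptNu H + 1 ≤ C.card := by
    intro C h1 h2
    by_contra h3
    exact hcon ⟨C, h1, h2, by omega⟩
  set S : Finset X := H.image Prod.fst with hS
  -- the cover inequality
  have hcov2 : ∀ σ ⊆ S, ∀ D : Finset H,
      (∀ e : H, e.1.1 ∈ σ → ∃ f ∈ D, (f.1.2 ∩ e.1.2).Nonempty) →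
      ptNu H + 1 + σ.card ≤ S.card + D.card := by
    intro σ hσ D hD
    have := hcov ((S \ σ).image Sum.inl ∪ D.image (fun f => Sum.inr f.1.2)) (by
      intro c hc
      rcases Finset.mem_union.1 hc with h | h
      · obtain ⟨x, hx, rfl⟩ := Finset.mem_image.1 h
        obtain ⟨e, he, rfl⟩ := Finset.mem_image.1 (Finset.mem_sdiff.1 hx).1
        exact Or.inl ⟨e, he, rfl⟩
      · obtain ⟨f, hf, rfl⟩ := Finset.mem_image.1 h
        exact Or.inr ⟨f.1, f.2, rfl⟩) (by
      intro e he
      by_cases h : e.1 ∈ σ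
      · obtain ⟨f, hf, hne⟩ := hD ⟨e, he⟩ h
        exact ⟨Sum.inr f.1.2, Finset.mem_union_right _ (Finset.mem_image.2 ⟨f, hf, rfl⟩),
          Or.inr ⟨_, rfl, hne⟩⟩
      · exact ⟨Sum.inl e.1, Finset.mem_union_left _ (Finset.mem_image_of_mem _
          (Finset.mem_sdiff.2 ⟨Finset.mem_image_of_mem _ he, h⟩)), Or.inl rfl⟩)
    have h1 := Finset.card_union_le ((S \ σ).image (Sum.inl : X → X ⊕ Finset W))
      (D.image (fun f => (Sum.inr f.1.2 : X ⊕ Finset W)))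
    have h2 := Finset.card_image_le (s := S \ σ) (f := (Sum.inl : X → X ⊕ Finset W))
    have h3 := Finset.card_image_le (s := D) (f := fun f => (Sum.inr f.1.2 : X ⊕ Finset W))
    have h4 := Finset.card_sdiff_add_card_eq_card hσ
    omega
  have hνS : ptNu H + 1 ≤ S.card := by
    have := hcov2 ∅ (by simp) ∅ (by simp)
    simpa using this
  obtain ⟨d, hd⟩ := Nat.exists_eq_add_of_le hνS
  obtain ⟨s, hsind, hsrb⟩ := rainbow (conflict H d) (by
      rintro (a | a)
      · simpa [conflict] using (htrees a.1 a.2).1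
      · simp [conflict]) (by
      rintro (a | a) (b | b) h
      · simp only [conflict] at h ⊢
        rwa [Finset.inter_comm]
      · exact h
      · exact h
      · simp only [conflict] at h ⊢
        exact h.symm) (by
      intro U hU
      by_cases hL : U.toLeft.Nonempty
      · obtain ⟨e, he, hes⟩ := simplicial_exists T hT H htrees U.toLeft hL
        refine ⟨Sum.inl e, by simpa using he, ?_⟩
        rintro (a | a) ha (b | b) hb h1 h2
        · exact hes a (by simpa using ha) b (by simpa using hb) h1 h2
        · exact h2.elim
        · exact h1.elim
        · exact h1.elim
      · obtain ⟨(e | e), he⟩ := hU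
        · exact absurd ⟨e, by simpa using he⟩ hL
        · refine ⟨Sum.inr e, he, ?_⟩
          rintro (a | a) ha (b | b) hb h1 h2
          · exact h1.elim
          · exact h1.elim
          · exact h2.elim
          · simp only [conflict] at *
            rw [← h1, ← h2])
    (Sum.elim (fun a => a.1.1) (fun a => a.2)) S (by
      intro σ hσ D hD hdom
      rcases σ.eq_empty_or_nonempty with rfl | ⟨x, hx⟩
      · simp
      have h1 := hcov2 σ hσ D.toLeft (by
        intro e he
        obtain ⟨(f | f), hf, hR⟩ := hdom (Sum.inl e) (by simpa using he)
        · exact ⟨f, by simpa using hf, hR⟩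
        · exact hR.elim)
      have h2 : d ≤ D.toRight.card := by
        have : (Finset.univ : Finset (Fin d)) ⊆ D.toRight.image Prod.fst := by
          intro i _
          obtain ⟨(f | f), hf, hR⟩ := hdom (Sum.inr (i, x)) (by simpa using hx)
          · exact hR.elim
          · exact Finset.mem_image.2 ⟨f, by simpa using hf, hR⟩
        have h3 := (Finset.card_le_card this).trans Finset.card_image_le
        simpa using h3
      have h3 := Finset.card_toLeft_add_card_toRight (u := D)
      omega)
  have hright : s.toRight.card ≤ d := by
    have : (s.toRight.image Prod.fst).card = s.toRight.card := by
      rw [Finset.card_image_iff]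
      intro a ha b hb hab
      by_contra hne
      exact hsind (Sum.inr a) (by simpa using ha) (Sum.inr b) (by simpa using hb)
        (by simpa using hne) hab
    rw [← this]
    simpa using Finset.card_le_univ (s.toRight.image Prod.fst)
  have hcard := Finset.card_toLeft_add_card_toRight (u := s)
  have hinj := hsrb.injOn
  rw [hsrb.2] at hcard
  have hM : s.toLeft.card ≤ ptNu H := by
    refine le_csSup ⟨H.card, ?_⟩ ⟨s.toLeft.map (Function.Embedding.subtype _), ?_, ?_, by simp⟩
    · rintro n ⟨M, hM, -, rfl⟩
      exact Finset.card_le_card hM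
    · intro e he
      obtain ⟨a, -, rfl⟩ := Finset.mem_map.1 he
      exact a.2
    · intro e he f hf hne
      obtain ⟨a, ha, rfl⟩ := Finset.mem_map.1 he
      obtain ⟨b, hb, rfl⟩ := Finset.mem_map.1 hf
      have ha' : Sum.inl a ∈ s := by simpa using ha
      have hb' : Sum.inl b ∈ s := by simpa using hb
      have hab : (Sum.inl a : H ⊕ (Fin d × X)) ≠ Sum.inl b := by
        intro h
        exact hne (by rw [Sum.inl.inj h])
      refine ⟨fun h => hab (hinj ha' hb' h), ?_⟩
      have h2 : ¬ (a.1.2 ∩ b.1.2).Nonempty := hsind _ ha' _ hb' hab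
      rw [Finset.disjoint_iff_inter_eq_empty]
      exact Finset.not_nonempty_iff_eq_empty.1 h2
  omega
end

section
/- Let 𝒜 be a finite family of hypergraphs (on a common vertex set) with deficiency d, i.e., mw(⋃ℬ) ≥ |ℬ| − d for every subfamily ℬ ⊆ 𝒜. Then there is a subfamily 𝒟 ⊆ 𝒜 with |𝒟| ≤ d such that 𝒜 \ 𝒟 admits a system of pairwise disjoint representatives (a choice of one edge from each hypergraph in 𝒜 \ 𝒟, all pairwise disjoint). [May be proved assuming the Aharoni–Haxell theorem: if mw(⋃ℬ) ≥ |ℬ| for all ℬ ⊆ 𝒜 then 𝒜 has a system of disjoint representatives.] -/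
variable {V : Type*} [Fintype V] [DecidableEq V]

/-- `C` covers `H`: every edge of `H` meets some edge of `C`. -/
def Covers (C H : Finset (Finset V)) : Prop :=
  ∀ e ∈ H, ∃ c ∈ C, (e ∩ c).Nonempty

/-- A matching: pairwise disjoint edges. -/
def IsHypMatching (M : Finset (Finset V)) : Prop :=
  ∀ x ∈ M, ∀ y ∈ M, x ≠ y → Disjoint x y

/-- `w(M, H)`: minimal size of a subset of `H` covering `M`. -/
noncomputable def coverNum (M H : Finset (Finset V)) : ℕ :=
  sInf {n | ∃ C ⊆ H, Covers C M ∧ C.card = n}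

/-- The matching width `mw(H)`. -/
noncomputable def matchingWidth (H : Finset (Finset V)) : ℕ :=
  sSup {n | ∃ M ⊆ H, IsHypMatching M ∧ coverNum M H = n}

namespace AH

open Finset

abbrev Ch (X : Type*) := Finset X →₀ ZMod 2

section
variable {X : Type*} [DecidableEq X]

lemma add_self_zero {N : Type*} [AddCommGroup N] [Module (ZMod 2) N] (a : N) : a + a = 0 := by
  have h : (2 : ZMod 2) • a = 0 := by
    rw [show (2 : ZMod 2) = 0 from rfl, zero_smul]
  rwa [two_smul] at h

lemma double_erase {N : Type*} [AddCommGroup N] [Module (ZMod 2) N]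
    (g : Finset X → N) (s : Finset X) :
    ∑ x ∈ s, ∑ y ∈ s.erase x, g ((s.erase x).erase y) = 0 := by
  rw [Finset.sum_sigma']
  refine Finset.sum_involution (fun p _ => ⟨p.2, p.1⟩) ?_ ?_ ?_ ?_
  · rintro ⟨x, y⟩ _
    simp only
    rw [Finset.erase_right_comm]
    exact add_self_zero _
  · rintro ⟨x, y⟩ h _ h2
    simp only [mem_sigma, mem_erase] at h
    simp only [Sigma.mk.injEq] at h2
    exact h.2.1 h2.1
  · rintro ⟨x, y⟩ h
    simp only [mem_sigma, mem_erase] at h ⊢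
    exact ⟨h.2.2, fun e => h.2.1 e.symm, h.1⟩
  · rintro ⟨x, y⟩ _
    rfl

/-- linear extension -/
noncomputable def ext {N : Type*} [AddCommGroup N] [Module (ZMod 2) N] (g : Finset X → N) :
    Ch X →ₗ[ZMod 2] N := Finsupp.linearCombination (ZMod 2) g

lemma ext_single {N : Type*} [AddCommGroup N] [Module (ZMod 2) N] (g : Finset X → N)
    (s : Finset X) : ext g (Finsupp.single s 1) = g s := by
  simp [ext]

noncomputable def sg (s : Finset X) : Ch X := Finsupp.single s 1

@[simp] lemma ext_sg {N : Type*} [AddCommGroup N] [Module (ZMod 2) N] (g : Finset X → N)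
    (s : Finset X) : ext g (sg s) = g s := ext_single g s

lemma lin_ext {N : Type*} [AddCommGroup N] [Module (ZMod 2) N] {f g : Ch X →ₗ[ZMod 2] N}
    (h : ∀ s, f (sg s) = g (sg s)) : f = g := by
  apply Finsupp.lhom_ext'
  intro s
  ext
  exact h s

noncomputable def bd : Ch X →ₗ[ZMod 2] Ch X := ext fun s => ∑ x ∈ s, sg (s.erase x)

noncomputable def cone (w : X) : Ch X →ₗ[ZMod 2] Ch X :=
  ext fun s => if w ∈ s then 0 else sg (insert w s)

lemma bd_sg (s : Finset X) : bd (sg s) = ∑ x ∈ s, sg (s.erase x) := by simp [bd]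

lemma cone_sg (w : X) (s : Finset X) :
    cone w (sg s) = if w ∈ s then 0 else sg (insert w s) := by simp [cone]

lemma bd_bd (c : Ch X) : bd (bd c) = 0 := by
  have : (bd (X := X)).comp bd = 0 := by
    apply lin_ext
    intro s
    simp only [LinearMap.comp_apply, bd_sg, map_sum, LinearMap.zero_apply]
    exact double_erase sg s
  exact LinearMap.congr_fun this c

lemma bd_cone (w : X) (c : Ch X) : bd (cone w c) = c + cone w (bd c) := by
  have : (bd (X := X)).comp (cone w) = LinearMap.id + (cone w).comp bd := by
    apply lin_ext
    intro s
    simp only [LinearMap.comp_apply, LinearMap.add_apply, LinearMap.id_apply, bd_sg, map_sum,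
      cone_sg]
    by_cases hw : w ∈ s
    · rw [if_pos hw, map_zero, Finset.sum_eq_single w]
      · simp [Finset.insert_erase hw, add_self_zero]
      · intro b _ hbw
        rw [if_pos]
        simp [hw, hbw.symm]
      · exact fun h => absurd hw h
    · rw [if_neg hw, bd_sg, Finset.sum_insert hw, Finset.erase_insert hw]
      congr 1
      apply Finset.sum_congr rfl
      intro x hx
      have hxw : w ≠ x := fun h => hw (h ▸ hx)
      rw [if_neg (fun h => hw (Finset.mem_of_mem_erase h)),
        Finset.erase_insert_of_ne hxw]
  exact LinearMap.congr_fun this c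

noncomputable def hh (w : Finset X → X) (s : Finset X) : Ch X :=
  cone (w s) (sg s + ∑ x ∈ s.attach, hh w (s.erase x.1))
termination_by s.card
decreasing_by exact Finset.card_erase_lt_of_mem x.2

lemma hh_eq (w : Finset X → X) (s : Finset X) :
    hh w s = cone (w s) (sg s + ext (hh w) (bd (sg s))) := by
  rw [hh, bd_sg, map_sum, Finset.sum_attach s (fun x => hh w (s.erase x))]
  simp

lemma bd_hh (w : Finset X → X) (s : Finset X) :
    bd (hh w s) = sg s + ext (hh w) (bd (sg s)) := by
  induction hn : s.card using Nat.strong_induction_on generalizing s with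
  | _ n ih =>
    have key : bd (ext (hh w) (bd (sg s))) = bd (sg s) := by
      have h1 : bd (ext (hh w) (bd (sg s)))
          = ∑ x ∈ s, (sg (s.erase x) + ext (hh w) (bd (sg (s.erase x)))) := by
        rw [bd_sg, map_sum, map_sum]
        apply Finset.sum_congr rfl
        intro x hx
        rw [ext_sg]
        exact ih _ (hn ▸ Finset.card_erase_lt_of_mem hx) _ rfl
      rw [h1, Finset.sum_add_distrib, ← map_sum, ← map_sum, ← bd_sg, bd_bd, map_zero, add_zero]
    rw [hh_eq, bd_cone, map_add, key, add_self_zero, map_zero, add_zero]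

lemma bd_ext_hh (w : Finset X → X) (c : Ch X) :
    bd (ext (hh w) c) = c + ext (hh w) (bd c) := by
  have : (bd (X := X)).comp (ext (hh w)) = LinearMap.id + (ext (hh w)).comp bd := by
    apply lin_ext
    intro s
    simp [bd_hh]
  exact LinearMap.congr_fun this c

/-- chains supported on a set -/
noncomputable def Sup (P : Finset X → Prop) : Submodule (ZMod 2) (Ch X) :=
  Submodule.span (ZMod 2) (sg '' {s | P s})

lemma sg_mem {P : Finset X → Prop} {s : Finset X} (h : P s) : sg s ∈ Sup P :=
  Submodule.subset_span ⟨s, h, rfl⟩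

lemma map_mem {N : Type*} [AddCommGroup N] [Module (ZMod 2) N] {P : Finset X → Prop}
    (f : Ch X →ₗ[ZMod 2] N) (Q : Submodule (ZMod 2) N)
    (h : ∀ s, P s → f (sg s) ∈ Q) {c : Ch X} (hc : c ∈ Sup P) : f c ∈ Q := by
  have : Sup P ≤ Q.comap f := by
    apply Submodule.span_le.2
    rintro _ ⟨s, hs, rfl⟩
    exact h s hs
  exact this hc

lemma map_eq {N : Type*} [AddCommGroup N] [Module (ZMod 2) N] {P : Finset X → Prop}
    (f g : Ch X →ₗ[ZMod 2] N)
    (h : ∀ s, P s → f (sg s) = g (sg s)) {c : Ch X} (hc : c ∈ Sup P) : f c = g c := by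
  have := map_mem (f - g) ⊥ (fun s hs => by simp [h s hs]) hc
  simpa [sub_eq_zero] using this

lemma sup_mono {P Q : Finset X → Prop} (h : ∀ s, P s → Q s) : Sup P ≤ Sup Q :=
  Submodule.span_mono (Set.image_mono h)

/-- independent sets -/
def Ind (R : X → X → Prop) (s : Finset X) : Prop := ∀ x ∈ s, ∀ y ∈ s, x ≠ y → ¬ R x y

lemma hh_supp (R : X → X → Prop) (hR : ∀ x y, R x y → R y x) (I : Finset X) (hI : Ind R I)
    (w : Finset X → X) (k : ℕ) (s : Finset X) (hs : Ind R s) (hk : s.card < k)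
    (hw : ∀ t ⊆ s, w t ∈ I ∧ ∀ y ∈ t, ¬ R (w t) y) :
    hh w s ∈ Sup (fun r => Ind R r ∧ r ⊆ s ∪ I ∧ r.card = s.card + 1) := by
  induction hn : s.card using Nat.strong_induction_on generalizing s with
  | _ n ih =>
    subst hn
    rw [hh_eq]
    refine map_mem (P := fun r => Ind R r ∧ r ⊆ s ∪ I ∧ r.card = s.card) _ _ ?_ ?_
    · rintro r ⟨h1, h2, h3⟩
      rw [cone_sg]
      split_ifs with hwr
      · exact Submodule.zero_mem _
      · apply sg_mem
        obtain ⟨hwI, hws⟩ := hw s subset_rfl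
        have hnon : ∀ y ∈ r, w s ≠ y → ¬ R (w s) y := by
          intro y hy hne
          rcases Finset.mem_union.1 (h2 hy) with h | h
          · exact hws y h
          · exact hI _ hwI _ h hne
        refine ⟨?_, ?_, by rw [Finset.card_insert_of_notMem hwr, h3]⟩
        · intro x hx y hy hxy
          rcases Finset.mem_insert.1 hx with rfl | hx
          · rcases Finset.mem_insert.1 hy with rfl | hy
            · exact absurd rfl hxy
            · exact hnon y hy hxy
          · rcases Finset.mem_insert.1 hy with rfl | hy
            · exact fun h => hnon x hx hxy.symm (hR _ _ h)
            · exact h1 x hx y hy hxy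
        · exact Finset.insert_subset (Finset.mem_union_right _ hwI) h2
    · apply Submodule.add_mem
      · exact sg_mem ⟨hs, Finset.subset_union_left, rfl⟩
      · rw [bd_sg, map_sum]
        apply Submodule.sum_mem
        intro x hx
        rw [ext_sg]
        have hlt := Finset.card_erase_lt_of_mem hx
        have hsub := Finset.erase_subset x s
        have := ih _ hlt (s.erase x) (fun a ha b hb => hs a (hsub ha) b (hsub hb))
          (hlt.trans hk) (fun t ht => hw t (ht.trans hsub)) rfl
        refine sup_mono ?_ this
        rintro r ⟨h1, h2, h3⟩
        refine ⟨h1, h2.trans (Finset.union_subset_union_left hsub), ?_⟩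
        rw [h3, Finset.card_erase_add_one hx]

end

section
variable {X ι : Type*} [DecidableEq X] [DecidableEq ι]

noncomputable def cc (w : Finset ι → Finset X → X) (B : Finset ι) : Ch X :=
  if B = ∅ then sg ∅ else ext (hh (w B)) (∑ i ∈ B.attach, cc w (B.erase i.1))
termination_by B.card
decreasing_by exact Finset.card_erase_lt_of_mem i.2

lemma cc_empty (w : Finset ι → Finset X → X) : cc w ∅ = sg ∅ := by
  rw [cc, if_pos rfl]

lemma cc_eq (w : Finset ι → Finset X → X) (B : Finset ι) (hB : B ≠ ∅) :
    cc w B = ext (hh (w B)) (∑ i ∈ B, cc w (B.erase i)) := by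
  rw [cc, if_neg hB, Finset.sum_attach B (fun i => cc w (B.erase i))]

lemma bd_cc (w : Finset ι → Finset X → X) (B : Finset ι) :
    bd (cc w B) = ∑ i ∈ B, cc w (B.erase i) := by
  induction hn : B.card using Nat.strong_induction_on generalizing B with
  | _ n ih =>
    by_cases hB : B = ∅
    · subst hB
      simp [cc_empty, bd_sg]
    · rw [cc_eq w B hB, bd_ext_hh]
      have : bd (∑ i ∈ B, cc w (B.erase i)) = 0 := by
        rw [map_sum, ← double_erase (cc w) B]
        apply Finset.sum_congr rfl
        intro i hi
        exact ih _ (hn ▸ Finset.card_erase_lt_of_mem hi) _ rfl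
      rw [this, map_zero, add_zero]

lemma cc_supp (R : X → X → Prop) (hR : ∀ x y, R x y → R y x) (col : X → ι)
    (I : Finset ι → Finset X) (hI : ∀ B, Ind R (I B)) (hIc : ∀ B, (I B).image col ⊆ B)
    (w : Finset ι → Finset X → X)
    (hw : ∀ B t, t.card < B.card → t.image col ⊆ B → w B t ∈ I B ∧ ∀ y ∈ t, ¬ R (w B t) y)
    (B : Finset ι) :
    cc w B ∈ Sup (fun r => Ind R r ∧ r.image col ⊆ B ∧ r.card = B.card) := by
  induction hn : B.card using Nat.strong_induction_on generalizing B with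
  | _ n ih =>
    subst hn
    by_cases hB : B = ∅
    · subst hB
      rw [cc_empty]
      apply sg_mem
      simp [Ind]
    · rw [cc_eq w B hB]
      refine map_mem (P := fun r => Ind R r ∧ r.image col ⊆ B ∧ r.card + 1 = B.card) _ _ ?_ ?_
      · rintro s ⟨h1, h2, h3⟩
        rw [ext_sg]
        have := hh_supp R hR (I B) (hI B) (w B) B.card s h1 (by omega) (fun t ht =>
          hw B t (lt_of_le_of_lt (Finset.card_le_card ht) (by omega))
            ((Finset.image_subset_image ht).trans h2))
        refine sup_mono ?_ this
        rintro r ⟨g1, g2, g3⟩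
        refine ⟨g1, (Finset.image_subset_image g2).trans ?_, by omega⟩
        rw [Finset.image_union]
        exact Finset.union_subset h2 (hIc B)
      · apply Submodule.sum_mem
        intro i hi
        refine sup_mono ?_ (ih _ (Finset.card_erase_lt_of_mem hi) (B.erase i) rfl)
        rintro r ⟨g1, g2, g3⟩
        exact ⟨g1, g2.trans (Finset.erase_subset _ _),
          by rw [g3, Finset.card_erase_add_one hi]⟩

/-- counts rainbow simplices -/
noncomputable def rb (col : X → ι) (B : Finset ι) : Ch X →ₗ[ZMod 2] ZMod 2 :=
  ext fun s => if s.image col = B then 1 else 0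

lemma rb_sg (col : X → ι) (B : Finset ι) (s : Finset X) :
    rb col B (sg s) = if s.image col = B then 1 else 0 := by simp [rb]

lemma sperner (col : X → ι) (B : Finset ι) (i : ι) (hi : i ∈ B) (s : Finset X)
    (hs : s.image col ⊆ B) (hc : s.card = B.card) :
    rb col (B.erase i) (bd (sg s)) = rb col B (sg s) := by
  rw [bd_sg, map_sum]
  simp only [rb_sg]
  by_cases hinj : Set.InjOn col s
  · have him : s.image col = B :=
      Finset.eq_of_subset_of_card_le hs (by rw [Finset.card_image_of_injOn hinj, hc])
    rw [if_pos him]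
    obtain ⟨x, hx, rfl⟩ := Finset.mem_image.1 (him ▸ hi)
    have hq : ∀ y ∈ s, (s.erase y).image col = B.erase (col y) := by
      intro y hy
      ext j
      simp only [Finset.mem_image, Finset.mem_erase, ← him]
      constructor
      · rintro ⟨a, ⟨h1, h2⟩, rfl⟩
        exact ⟨fun h => h1 (hinj h2 hy h), a, h2, rfl⟩
      · rintro ⟨h1, a, h2, rfl⟩
        exact ⟨a, ⟨fun h => h1 (h ▸ rfl), h2⟩, rfl⟩
    rw [Finset.sum_eq_single x]
    · rw [if_pos (hq x hx)]
    · intro y hy hyx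
      rw [hq y hy, if_neg]
      intro h
      have h1 : col x ∈ B.erase (col y) :=
        Finset.mem_erase.2 ⟨fun h => hyx (hinj hx hy h).symm, hi⟩
      rw [h] at h1
      simp at h1
    · exact fun h => absurd hx h
  · have hlt : (s.image col).card < s.card :=
      lt_of_le_of_ne Finset.card_image_le (fun h => hinj (Finset.card_image_iff.1 h))
    rw [if_neg (fun h => by rw [h] at hlt; omega)]
    have : ∃ x ∈ s, ∃ y ∈ s, col x = col y ∧ x ≠ y := by
      unfold Set.InjOn at hinj
      push Not at hinj
      obtain ⟨x, hx, y, hy, h⟩ := hinj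
      exact ⟨x, hx, y, hy, h⟩
    obtain ⟨x, hx, y, hy, hxy, hne⟩ := this
    have key : ∀ x ∈ s, ∀ y ∈ s, col x = col y → x ≠ y →
        (s.erase x).image col = s.image col := by
      intro x hx y hy hxy hne
      apply subset_antisymm (Finset.image_subset_image (Finset.erase_subset _ _))
      intro j hj
      obtain ⟨a, ha, rfl⟩ := Finset.mem_image.1 hj
      by_cases hax : a = x
      · subst hax
        exact Finset.mem_image.2 ⟨y, Finset.mem_erase.2 ⟨hne.symm, hy⟩, hxy.symm⟩
      · exact Finset.mem_image.2 ⟨a, Finset.mem_erase.2 ⟨hax, ha⟩, rfl⟩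
    have hsub : ({x, y} : Finset X) ⊆ s := by
      intro a ha
      simp only [Finset.mem_insert, Finset.mem_singleton] at ha
      rcases ha with rfl | rfl <;> assumption
    rw [← Finset.sum_subset hsub, Finset.sum_pair hne, key x hx y hy hxy hne,
      key y hy x hx hxy.symm hne.symm]
    · exact add_self_zero _
    · intro z hz hzn
      simp only [Finset.mem_insert, Finset.mem_singleton, not_or] at hzn
      rw [if_neg]
      intro h
      have h1 : ((s.erase z).image col).card < (s.erase z).card := by
        refine lt_of_le_of_ne Finset.card_image_le (fun h => ?_)
        have := Finset.card_image_iff.1 h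
        exact hne (this (by simp [hx, Ne.symm hzn.1]) (by simp [hy, Ne.symm hzn.2]) hxy)
      rw [h, Finset.card_erase_of_mem hi, Finset.card_erase_of_mem hz, hc] at h1
      exact lt_irrefl _ h1

theorem rainbow (R : X → X → Prop) (hR : ∀ x y, R x y → R y x) (col : X → ι)
    (I : Finset ι → Finset X) (hI : ∀ B, Ind R (I B)) (hIc : ∀ B, (I B).image col ⊆ B)
    (hdom : ∀ (B : Finset ι) (t : Finset X), t.card < B.card → t.image col ⊆ B → ∃ v ∈ I B, ∀ y ∈ t, ¬ R v y)
    (B : Finset ι) : ∃ s : Finset X, Ind R s ∧ s.image col = B := by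
  by_cases hB : B = ∅
  · exact ⟨∅, by simp [Ind], by simp [hB]⟩
  have hX : Nonempty X := by
    obtain ⟨v, _⟩ := hdom B ∅ (by simpa using Finset.card_pos.2 (Finset.nonempty_iff_ne_empty.2 hB))
      (by simp)
    exact ⟨v⟩
  have : ∀ (B : Finset ι) (t : Finset X), ∃ v, t.card < B.card → t.image col ⊆ B → v ∈ I B ∧ ∀ y ∈ t, ¬ R v y := by
    intro B t
    by_cases h : t.card < B.card ∧ t.image col ⊆ B
    · obtain ⟨v, hv⟩ := hdom B t h.1 h.2
      exact ⟨v, fun _ _ => hv⟩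
    · exact ⟨hX.some, fun h1 h2 => absurd ⟨h1, h2⟩ h⟩
  choose w hw using this
  have hsupp := cc_supp R hR col I hI hIc w hw
  have hone : ∀ B, rb col B (cc w B) = 1 := by
    intro B
    induction hn : B.card using Nat.strong_induction_on generalizing B with
    | _ n ih =>
      by_cases hB : B = ∅
      · subst hB
        simp [cc_empty, rb_sg]
      · obtain ⟨i, hi⟩ := Finset.nonempty_iff_ne_empty.2 hB
        have h1 : ((rb col (B.erase i)).comp bd) (cc w B) = rb col B (cc w B) :=
          map_eq _ _ (fun s hs => sperner col B i hi s hs.2.1 hs.2.2) (hsupp B)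
        rw [← h1, LinearMap.comp_apply, bd_cc, map_sum, Finset.sum_eq_single i]
        · exact ih _ (hn ▸ Finset.card_erase_lt_of_mem hi) _ rfl
        · intro j hj hji
          have := map_eq (rb col (B.erase i)) 0 (fun s hs => ?_) (hsupp (B.erase j))
          · simpa using this
          · rw [rb_sg, if_neg, LinearMap.zero_apply]
            intro h
            have h2 : j ∈ s.image col := by rw [h]; exact Finset.mem_erase.2 ⟨hji, hj⟩
            simpa using hs.2.1 h2
        · exact fun h => absurd hi h
  by_contra hcon
  push Not at hcon
  have := map_eq (rb col B) 0 (fun s hs => by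
    rw [rb_sg, if_neg (hcon s hs.1), LinearMap.zero_apply]) (hsupp B)
  rw [hone B] at this
  simp at this

end

end AH

theorem stmt13 {ι : Type} [Fintype ι] [DecidableEq ι]
    (A : ι → Finset (Finset V)) (d : ℕ)
    (hdef : ∀ B : Finset ι, B.card - d ≤ matchingWidth (B.biUnion A))
    (aharoniHaxell : ∀ (κ : Type) [Fintype κ] [DecidableEq κ]
      (A' : κ → Finset (Finset V)),
      (∀ B : Finset κ, B.card ≤ matchingWidth (B.biUnion A')) →
      ∃ f : κ → Finset V, (∀ i, f i ∈ A' i) ∧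
        ∀ i j, i ≠ j → Disjoint (f i) (f j)) :
    ∃ D : Finset ι, D.card ≤ d ∧
      ∃ f : {i : ι // i ∉ D} → Finset V, (∀ i, f i ∈ A i.1) ∧
        ∀ i j, i ≠ j → Disjoint (f i) (f j) := by
  classical
  let X := {p : ι × (Finset V ⊕ Fin d) // ∀ e, p.2 = Sum.inl e → e ∈ A p.1}
  let R : X → X → Prop := fun x y =>
    (∃ e e', x.1.2 = Sum.inl e ∧ y.1.2 = Sum.inl e' ∧ ¬ Disjoint e e') ∨
    (∃ k, x.1.2 = Sum.inr k ∧ y.1.2 = Sum.inr k)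
  let col : X → ι := fun x => x.1.1
  have hR : ∀ x y, R x y → R y x := by
    rintro x y (⟨e, e', h1, h2, h3⟩ | ⟨k, h1, h2⟩)
    · exact Or.inl ⟨e', e, h2, h1, fun h => h3 h.symm⟩
    · exact Or.inr ⟨k, h2, h1⟩
  have hex : ∀ B : Finset ι, ∃ I : Finset X, AH.Ind R I ∧ I.image col ⊆ B ∧
      ∀ t : Finset X, t.card < B.card → t.image col ⊆ B → ∃ v ∈ I, ∀ y ∈ t, ¬ R v y := by
    intro B
    by_cases hB : B = ∅
    · exact ⟨∅, by simp [AH.Ind], by simp, by simp [hB]⟩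
    obtain ⟨i0, hi0⟩ := Finset.nonempty_iff_ne_empty.2 hB
    have hM : ∃ M ⊆ B.biUnion A, IsHypMatching M ∧ B.card - d ≤ coverNum M (B.biUnion A) := by
      by_cases h0 : B.card - d = 0
      · exact ⟨∅, by simp, by simp [IsHypMatching], by omega⟩
      · have hlt : B.card - d - 1 < matchingWidth (B.biUnion A) := by
          have := hdef B
          omega
        have hne : {n | ∃ M ⊆ B.biUnion A, IsHypMatching M ∧
            coverNum M (B.biUnion A) = n}.Nonempty :=
          ⟨_, ∅, by simp, by simp [IsHypMatching], rfl⟩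
        obtain ⟨n, ⟨M, h1, h2, h3⟩, hn⟩ := exists_lt_of_lt_csSup hne hlt
        exact ⟨M, h1, h2, by omega⟩
    obtain ⟨M, hMs, hMm, hMc⟩ := hM
    -- the independent set, described by a predicate
    have hc : ∀ e : Finset V, ∃ i, e ∈ M → i ∈ B ∧ e ∈ A i := by
      intro e
      by_cases he : e ∈ M
      · obtain ⟨i, hi⟩ := Finset.mem_biUnion.1 (hMs he)
        exact ⟨i, fun _ => hi⟩
      · exact ⟨i0, fun h => absurd h he⟩
    choose c hc using hc
    let I : Finset X := Finset.univ.filter fun x =>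
      (∃ e ∈ M, x.1 = (c e, Sum.inl e)) ∨ (∃ k, x.1 = (i0, Sum.inr k))
    refine ⟨I, ?_, ?_, ?_⟩
    · intro x hx y hy hxy
      simp only [I, Finset.mem_filter, Finset.mem_univ, true_and] at hx hy
      rintro (⟨e, e', h1, h2, h3⟩ | ⟨k, h1, h2⟩)
      · rcases hx with ⟨a, ha, hx⟩ | ⟨a, hx⟩
        swap
        · simp [hx] at h1
        rcases hy with ⟨b, hb, hy⟩ | ⟨b, hy⟩
        swap
        · simp [hy] at h2
        simp only [hx, hy, Sum.inl.injEq] at h1 h2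
        subst h1 h2
        refine h3 (hMm a ha b hb fun h => hxy ?_)
        subst h
        exact Subtype.ext (hx.trans hy.symm)
      · rcases hx with ⟨a, ha, hx⟩ | ⟨a, hx⟩
        · simp [hx] at h1
        rcases hy with ⟨b, hb, hy⟩ | ⟨b, hy⟩
        · simp [hy] at h2
        simp only [hx, hy, Sum.inr.injEq] at h1 h2
        subst h1 h2
        exact hxy (Subtype.ext (hx.trans hy.symm))
    · intro i hi
      obtain ⟨x, hx, rfl⟩ := Finset.mem_image.1 hi
      simp only [I, Finset.mem_filter, Finset.mem_univ, true_and] at hx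
      rcases hx with ⟨a, ha, hx⟩ | ⟨a, hx⟩
      · simp only [col, hx]
        exact (hc a ha).1
      · simp only [col, hx]
        exact hi0
    · intro t ht htc
      by_cases hk : ∃ k : Fin d, ∀ y ∈ t, y.1.2 ≠ Sum.inr k
      · obtain ⟨k, hk⟩ := hk
        refine ⟨⟨(i0, Sum.inr k), by simp⟩, by simp [I], ?_⟩
        rintro y hy (⟨e, e', h1, h2, h3⟩ | ⟨k', h1, h2⟩)
        · simp at h1
        · simp only [Sum.inr.injEq] at h1
          subst h1
          exact hk y hy h2
      · push Not at hk
        let val : X → Finset V ⊕ Fin d := fun x => x.1.2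
        let C : Finset (Finset V) := (t.image val).toLeft
        have hC : C ⊆ B.biUnion A := by
          intro e he
          simp only [C, Finset.mem_toLeft, Finset.mem_image] at he
          obtain ⟨x, hx, hxe⟩ := he
          exact Finset.mem_biUnion.2 ⟨x.1.1, htc (Finset.mem_image.2 ⟨x, hx, rfl⟩), x.2 e hxe⟩
        have hright : (t.image val).toRight = Finset.univ := by
          ext k
          simp only [Finset.mem_toRight, Finset.mem_image, Finset.mem_univ, iff_true]
          obtain ⟨y, hy, h⟩ := hk k
          exact ⟨y, hy, h⟩
        have hcard : C.card + d ≤ t.card := by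
          have h1 := Finset.card_toLeft_add_card_toRight (u := t.image val)
          rw [hright, Finset.card_univ, Fintype.card_fin] at h1
          have h2 : (t.image val).card ≤ t.card := Finset.card_image_le
          simp only [C]
          omega
        have hnc : ¬ Covers C M := by
          intro h
          have : coverNum M (B.biUnion A) ≤ C.card := Nat.sInf_le ⟨C, hC, h, rfl⟩
          omega
        unfold Covers at hnc
        push Not at hnc
        obtain ⟨e, he, hec⟩ := hnc
        refine ⟨⟨(c e, Sum.inl e), ?_⟩, ?_, ?_⟩
        · intro e' h
          simp only [Sum.inl.injEq] at h
          subst h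
          exact (hc _ he).2
        · simp only [I, Finset.mem_filter, Finset.mem_univ, true_and]
          exact Or.inl ⟨e, he, rfl⟩
        · rintro y hy (⟨a, e', h1, h2, h3⟩ | ⟨k', h1, h2⟩)
          · simp only [Sum.inl.injEq] at h1
            subst h1
            apply h3
            rw [Finset.disjoint_iff_inter_eq_empty]
            have := hec e' (by
              simp only [C, Finset.mem_toLeft, Finset.mem_image]
              exact ⟨y, hy, h2⟩)
            simpa using this
          · simp at h1
  choose I hI hIc hdom using hex
  obtain ⟨s, hs, hsc⟩ := AH.rainbow R hR col I hI hIc hdom Finset.univ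
  have : ∀ i, ∃ x ∈ s, col x = i := by
    intro i
    exact Finset.mem_image.1 (hsc ▸ Finset.mem_univ i)
  choose g hg hgc using this
  have hne : ∀ i j, i ≠ j → ¬ R (g i) (g j) := by
    intro i j hij
    exact hs _ (hg i) _ (hg j) (fun h => hij (by rw [← hgc i, ← hgc j, h]))
  refine ⟨Finset.univ.filter fun i => ∃ k, (g i).1.2 = Sum.inr k, ?_, ?_⟩
  · have hsel : ∀ i : ι, ∃ o : Option (Fin d), ∀ k, (g i).1.2 = Sum.inr k → o = some k := by
      intro i
      rcases h : (g i).1.2 with e | k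
      · exact ⟨none, by simp⟩
      · exact ⟨some k, by simp⟩
    choose o ho using hsel
    have := Finset.card_le_card_of_injOn (s := Finset.univ.filter fun i => ∃ k, (g i).1.2 = Sum.inr k)
      (t := (Finset.univ : Finset (Fin d)).map Function.Embedding.some) o ?_ ?_
    · simpa using this
    · intro i hi
      simp only [Finset.coe_filter, Finset.mem_univ, true_and, Set.mem_setOf_eq] at hi
      obtain ⟨k, hk⟩ := hi
      simp [ho i k hk]
    · intro i hi j hj hij
      simp only [Finset.coe_filter, Finset.mem_univ, true_and, Set.mem_setOf_eq] at hi hj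
      obtain ⟨k, hk⟩ := hi
      obtain ⟨l, hl⟩ := hj
      rw [ho i k hk, ho j l hl, Option.some.injEq] at hij
      subst hij
      by_contra hne'
      exact hne i j hne' (Or.inr ⟨k, hk, hl⟩)
  · have : ∀ i : {i : ι // i ∉ Finset.univ.filter fun i => ∃ k, (g i).1.2 = Sum.inr k},
        ∃ e, (g i.1).1.2 = Sum.inl e := by
      rintro ⟨i, hi⟩
      simp only [Finset.mem_filter, Finset.mem_univ, true_and] at hi
      rcases h : (g i).1.2 with e | k
      · exact ⟨e, rfl⟩
      · exact absurd ⟨k, h⟩ hi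
    choose f hf using this
    refine ⟨f, ?_, ?_⟩
    · intro i
      have h1 := (g i.1).2 _ (hf i)
      have h2 : (g i.1).1.1 = i.1 := hgc i.1
      rwa [h2] at h1
    · intro i j hij
      by_contra hd
      exact hne i.1 j.1 (fun h => hij (Subtype.ext h)) (Or.inl ⟨_, _, hf i, hf j, hd⟩)
end
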